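/- arXiv:1311.1055 — 2 statements merged into one kernel-verified Lean document; each statement's English description precedes it below -/
import Mathlib

section
/- Let n ≥ 1 and suppose all input data c > 0 (storage cost rate), λ > 0 (consumption rate), P ≥ 0 (demand), and, for i = 1,…,n, αᵢ ≥ 0, βᵢ ≥ 0, 0 < mᵢ ≤ Mᵢ, are positive integers (respectively nonnegative integers for αᵢ, βᵢ, P), and suppose ∑_{i=1}^{n} Mᵢ > P. Then there exist an optimal solution x* = (x*₁,…,x*ₙ) of the problem: minimize ∑_{i: xᵢ>0} (αᵢ + βᵢ·xᵢ) + ∑_{i=1}^{n} c·xᵢ²/(2λ) subject to ∑_{i=1}^{n} xᵢ ≥ P and xᵢ ∈ {0} ∪ [mᵢ, Mᵢ] for all i, and an integer H with 1 ≤ H ≤ n, such that H·c·x*ᵢ is an integer for every i = 1,…,n; in particular every fractional component of x* has the same denominator, which does not exceed n·c. -/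
open Filter Topology

section SupplyProblem

variable {ι : Type*} [Fintype ι]

/-- The feasible plans: demand `P` is met, and each delivery is `0` or lies in `[mᵢ, Mᵢ]`. -/
def IsFeasiblePlan (P : ℝ) (m M x : ι → ℝ) : Prop :=
  ∑ i, x i ≥ P ∧ ∀ i, x i = 0 ∨ (m i ≤ x i ∧ x i ≤ M i)

/-- The total transport and storage cost of a plan. -/
noncomputable def planCost (c l : ℝ) (α β x : ι → ℝ) : ℝ :=
  ∑ i, ((if 0 < x i then α i + β i * x i else 0) + c * x i ^ 2 / (2 * l))

/-- An optimal plan exists as soon as a feasible one does. The cost agrees on feasible plans with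
a continuous function, because each delivery there is `0` or at least `1`. -/
theorem exists_optimal_plan {P : ℝ} {m M : ι → ℝ} (c l : ℝ) (α β : ι → ℝ) (hm : ∀ i, 1 ≤ m i)
    (hmM : ∀ i, m i ≤ M i) (hP : P ≤ ∑ i, M i) :
    ∃ x, IsFeasiblePlan P m M x ∧
      ∀ y, IsFeasiblePlan P m M y → planCost c l α β x ≤ planCost c l α β y := by
  have hcompact : IsCompact {x | IsFeasiblePlan P m M x} := by
    have hclosed : IsClosed {x : ι → ℝ | ∑ i, x i ≥ P} :=
      isClosed_le continuous_const (by fun_prop)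
    have hbox : IsCompact (Set.univ.pi fun i => {0} ∪ Set.Icc (m i) (M i)) :=
      isCompact_univ_pi fun i => isCompact_singleton.union isCompact_Icc
    convert hbox.inter_left hclosed using 1
    ext x
    simp [IsFeasiblePlan]
  have heq : ∀ y, IsFeasiblePlan P m M y → planCost c l α β y =
      ∑ i, (α i * min (y i) 1 + β i * y i + c * y i ^ 2 / (2 * l)) := by
    intro y hy
    refine Finset.sum_congr rfl fun i _ => ?_
    rcases hy.2 i with h | ⟨h, -⟩
    · simp [h]
    · have h1 : 1 ≤ y i := (hm i).trans h
      rw [if_pos (by linarith), min_eq_right h1, mul_one]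
  obtain ⟨x, hx, hmin⟩ := hcompact.exists_isMinOn (f := fun y : ι → ℝ =>
    ∑ i, (α i * min (y i) 1 + β i * y i + c * y i ^ 2 / (2 * l)))
    ⟨M, hP, fun i => Or.inr ⟨hmM i, le_rfl⟩⟩ (by fun_prop)
  refine ⟨x, hx, fun y hy => ?_⟩
  rw [heq x hx, heq y hy]
  exact hmin hy

/-- First-order optimality condition: an optimal plan has nonnegative directional derivative of the
cost along each direction that moves only interior deliveries and keeps the demand met. -/
theorem sum_mul_marginal_cost_nonneg {P : ℝ} {m M x : ι → ℝ} {c l : ℝ} {α β : ι → ℝ}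
    (hm : ∀ i, 0 < m i) (hx : IsFeasiblePlan P m M x)
    (hopt : ∀ y, IsFeasiblePlan P m M y → planCost c l α β x ≤ planCost c l α β y)
    {d : ι → ℝ} (hd : ∀ i, d i ≠ 0 → m i < x i ∧ x i < M i)
    (hdP : 0 ≤ ∑ i, d i ∨ P < ∑ i, x i) :
    0 ≤ ∑ i, d i * (β i + c * x i / l) := by
  have hcoord : ∀ᶠ t in 𝓝[>] (0 : ℝ), ∀ i, d i ≠ 0 → m i < x i + t * d i ∧ x i + t * d i < M i := by
    rw [eventually_all]
    intro i
    by_cases hi : d i = 0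
    · simp [hi]
    have hlim : Tendsto (fun t => x i + t * d i) (𝓝[>] (0 : ℝ)) (𝓝 (x i)) := by
      have : ContinuousAt (fun t => x i + t * d i) 0 := by fun_prop
      simpa using this.tendsto.mono_left nhdsWithin_le_nhds
    filter_upwards [hlim.eventually (lt_mem_nhds (hd i hi).1),
      hlim.eventually (gt_mem_nhds (hd i hi).2)] with t h1 h2 _ using ⟨h1, h2⟩
  have hdemand : ∀ᶠ t in 𝓝[>] (0 : ℝ), P ≤ ∑ i, (x i + t * d i) := by
    simp_rw [Finset.sum_add_distrib, ← Finset.mul_sum]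
    rcases hdP with h | h
    · filter_upwards [self_mem_nhdsWithin] with t ht
      have := mul_nonneg (le_of_lt (Set.mem_Ioi.mp ht)) h
      linarith [hx.1]
    · have hlim : Tendsto (fun t => ∑ i, x i + t * ∑ i, d i) (𝓝[>] (0 : ℝ)) (𝓝 (∑ i, x i)) := by
        have : ContinuousAt (fun t => ∑ i, x i + t * ∑ i, d i) 0 := by fun_prop
        simpa using this.tendsto.mono_left nhdsWithin_le_nhds
      exact (hlim.eventually (lt_mem_nhds h)).mono fun _ => le_of_lt
  have hslope : ∀ᶠ t in 𝓝[>] (0 : ℝ),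
      0 ≤ ∑ i, d i * (β i + c * x i / l) + t * ∑ i, c * d i ^ 2 / (2 * l) := by
    filter_upwards [hcoord, hdemand, self_mem_nhdsWithin] with t h1 h2 ht
    have hle := hopt (fun i => x i + t * d i) ⟨h2, fun i => by
      by_cases hi : d i = 0
      · simpa [hi] using hx.2 i
      · exact Or.inr ⟨(h1 i hi).1.le, (h1 i hi).2.le⟩⟩
    have hexpand : planCost c l α β (fun i => x i + t * d i) = planCost c l α β x +
        t * (∑ i, d i * (β i + c * x i / l) + t * ∑ i, c * d i ^ 2 / (2 * l)) := by
      simp only [planCost, Finset.mul_sum, ← Finset.sum_add_distrib]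
      refine Finset.sum_congr rfl fun i _ => ?_
      by_cases hi : d i = 0
      · simp [hi]
      · rw [if_pos ((hm i).trans (h1 i hi).1), if_pos ((hm i).trans (hd i hi).1)]
        ring
    rw [hexpand] at hle
    exact nonneg_of_mul_nonneg_right (by linarith) (Set.mem_Ioi.mp ht)
  refine ge_of_tendsto (f := fun t => ∑ i, d i * (β i + c * x i / l) +
    t * ∑ i, c * d i ^ 2 / (2 * l)) ?_ hslope
  have : ContinuousAt (fun t => ∑ i, d i * (β i + c * x i / l) +
    t * ∑ i, c * d i ^ 2 / (2 * l)) 0 := by fun_prop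
  simpa using this.tendsto.mono_left nhdsWithin_le_nhds

/-- Interior deliveries of an optimal plan have the same marginal cost. -/
theorem marginal_cost_eq {P : ℝ} {m M x : ι → ℝ} {c l : ℝ} {α β : ι → ℝ}
    (hm : ∀ i, 0 < m i) (hx : IsFeasiblePlan P m M x)
    (hopt : ∀ y, IsFeasiblePlan P m M y → planCost c l α β x ≤ planCost c l α β y)
    {i j : ι} (hi : m i < x i ∧ x i < M i) (hj : m j < x j ∧ x j < M j) :
    β i + c * x i / l = β j + c * x j / l := by
  classical
  have key : ∀ {i j : ι}, m i < x i ∧ x i < M i → m j < x j ∧ x j < M j →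
      β j + c * x j / l ≤ β i + c * x i / l := by
    intro i j hi hj
    have h := sum_mul_marginal_cost_nonneg hm hx hopt
      (d := fun k => (if k = i then 1 else 0) - if k = j then 1 else 0) (fun k hk => by
        by_cases hki : k = i
        · exact hki ▸ hi
        by_cases hkj : k = j
        · exact hkj ▸ hj
        simp [hki, hkj] at hk) (by simp)
    simp only [sub_mul, Finset.sum_sub_distrib, ite_mul, one_mul, zero_mul,
      Finset.sum_ite_eq', Finset.mem_univ, if_true] at h
    linarith
  exact le_antisymm (key hj hi) (key hi hj)

/-- An optimal plan with an interior delivery meets the demand exactly. -/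
theorem sum_eq_demand {P : ℝ} {m M x : ι → ℝ} {c l : ℝ} {α β : ι → ℝ}
    (hc : 0 < c) (hl : 0 < l) (hβ : ∀ i, 0 ≤ β i)
    (hm : ∀ i, 0 < m i) (hx : IsFeasiblePlan P m M x)
    (hopt : ∀ y, IsFeasiblePlan P m M y → planCost c l α β x ≤ planCost c l α β y)
    {i : ι} (hi : m i < x i ∧ x i < M i) : ∑ k, x k = P := by
  classical
  refine le_antisymm (not_lt.mp fun hlt => ?_) hx.1
  have h := sum_mul_marginal_cost_nonneg hm hx hopt
    (d := fun k => -if k = i then 1 else 0) (fun k hk => by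
      by_cases hki : k = i
      · exact hki ▸ hi
      simp [hki] at hk) (Or.inr hlt)
  simp only [neg_mul, Finset.sum_neg_distrib, ite_mul, one_mul, zero_mul,
    Finset.sum_ite_eq', Finset.mem_univ, if_true] at h
  have hxi : 0 < x i := (hm i).trans hi.1
  have : 0 < c * x i / l := by positivity
  linarith [hβ i]

end SupplyProblem


/-- Theorem 1: with integer input data and `∑ Mᵢ > P`, the single-delivery
supply problem has an optimal solution `x*` and an integer `1 ≤ H ≤ n` such
that `H·c·x*ᵢ ∈ ℤ` for all `i`; in particular all fractional components of
`x*` share a common denominator not exceeding `n·c`. -/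
theorem exists_optimal_solution_with_common_denominator
    (n : ℕ) (hn : 1 ≤ n) (c lam : ℕ) (hc : 0 < c) (hlam : 0 < lam)
    (P : ℕ) (α β : Fin n → ℕ) (m M : Fin n → ℕ)
    (hm : ∀ i, 0 < m i) (hmM : ∀ i, m i ≤ M i)
    (hMP : (P : ℝ) < ∑ i, (M i : ℝ)) :
    ∃ (xstar : Fin n → ℝ) (H : ℕ),
      -- feasibility of `x*`
      ((∑ i, xstar i ≥ (P : ℝ)) ∧
        ∀ i, xstar i = 0 ∨ ((m i : ℝ) ≤ xstar i ∧ xstar i ≤ (M i : ℝ))) ∧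
      -- optimality of `x*`
      (∀ x : Fin n → ℝ,
        (∑ i, x i ≥ (P : ℝ)) →
        (∀ i, x i = 0 ∨ ((m i : ℝ) ≤ x i ∧ x i ≤ (M i : ℝ))) →
        (∑ i, ((if 0 < xstar i then (α i : ℝ) + (β i : ℝ) * xstar i else 0) +
            (c : ℝ) * (xstar i) ^ 2 / (2 * (lam : ℝ)))) ≤
        (∑ i, ((if 0 < x i then (α i : ℝ) + (β i : ℝ) * x i else 0) +
            (c : ℝ) * (x i) ^ 2 / (2 * (lam : ℝ))))) ∧
      -- the common denominator `H·c` with `1 ≤ H ≤ n`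
      1 ≤ H ∧ H ≤ n ∧ ∀ i, ∃ z : ℤ, (H : ℝ) * (c : ℝ) * xstar i = (z : ℝ) := by
  classical
  obtain ⟨x, hx, hopt⟩ := exists_optimal_plan (P := (P : ℝ)) (m := fun i => (m i : ℝ))
    (M := fun i => (M i : ℝ)) (c : ℝ) (lam : ℝ) (fun i => (α i : ℝ)) (fun i => (β i : ℝ))
    (fun i => by exact_mod_cast hm i) (fun i => by exact_mod_cast hmM i) hMP.le
  have hm0 : ∀ i, (0 : ℝ) < m i := fun i => by exact_mod_cast hm i
  have hc0 : (0 : ℝ) < c := by exact_mod_cast hc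
  have hl0 : (0 : ℝ) < lam := by exact_mod_cast hlam
  let Z : Subring ℝ := (Int.castRingHom ℝ).range
  let F : Finset (Fin n) := Finset.univ.filter fun i => (m i : ℝ) < x i ∧ x i < M i
  have hF : ∀ {i}, i ∈ F ↔ (m i : ℝ) < x i ∧ x i < M i := by simp [F]
  have hbd : ∀ i, i ∉ F → x i ∈ Z := by
    intro i hi
    rcases hx.2 i with h | ⟨h1, h2⟩
    · exact h ▸ zero_mem Z
    rcases h1.eq_or_lt with h | h
    · exact h ▸ natCast_mem Z (m i)
    rcases h2.eq_or_lt with h' | h'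
    · exact h' ▸ natCast_mem Z (M i)
    exact absurd (hF.mpr ⟨h, h'⟩) hi
  suffices h : ∃ H : ℕ, 1 ≤ H ∧ H ≤ n ∧ ∀ i, (H : ℝ) * (c : ℝ) * x i ∈ Z by
    obtain ⟨H, h1, h2, h3⟩ := h
    exact ⟨x, H, hx, fun y hy1 hy2 => hopt y ⟨hy1, hy2⟩, h1, h2, fun i =>
      (h3 i).imp fun z hz => hz.symm⟩
  rcases F.eq_empty_or_nonempty with hE | hne
  · refine ⟨1, le_rfl, hn, fun i => ?_⟩
    exact mul_mem (mul_mem (natCast_mem Z 1) (natCast_mem Z c)) (hbd i (by simp [hE]))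
  refine ⟨F.card, hne.card_pos, by simpa using F.card_le_univ, fun j => ?_⟩
  by_cases hj : j ∈ F
  swap
  · exact mul_mem (mul_mem (natCast_mem Z _) (natCast_mem Z c)) (hbd j hj)
  have hsum := sum_eq_demand hc0 hl0 (fun i => Nat.cast_nonneg (β i)) hm0 hx hopt (hF.mp hj)
  have hdiff : ∀ i ∈ F, (c : ℝ) * x j = c * x i - lam * (β j - β i) := by
    intro i hi
    have h := marginal_cost_eq hm0 hx hopt (hF.mp hi) (hF.mp hj)
    field_simp at h
    linarith
  have hcard : (F.card : ℝ) * c * x j =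
      c * (P - ∑ i ∈ Fᶜ, x i) - ∑ i ∈ F, (lam : ℝ) * (β j - β i) := by
    rw [← hsum, ← Finset.sum_add_sum_compl F x, add_sub_cancel_right, Finset.mul_sum,
      ← Finset.sum_sub_distrib, ← Finset.sum_congr rfl hdiff, Finset.sum_const, nsmul_eq_mul,
      mul_assoc]
  rw [hcard]
  exact sub_mem (mul_mem (natCast_mem Z c) (sub_mem (natCast_mem Z P)
    (sum_mem fun i hi => hbd i (Finset.mem_compl.mp hi))))
    (sum_mem fun i _ => mul_mem (natCast_mem Z lam) (sub_mem (natCast_mem Z _) (natCast_mem Z _)))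
end

section
/- Let n ≥ 1, c > 0, λ > 0, P ≥ 0, and for i = 1,…,n let αᵢ ≥ 0, βᵢ ≥ 0 and 0 < mᵢ ≤ Mᵢ. Suppose x* = (x*₁,…,x*ₙ) is an optimal solution of: minimize ∑_{i: xᵢ>0} (αᵢ + βᵢ·xᵢ) + ∑_{i=1}^{n} c·xᵢ²/(2λ) subject to ∑_{i=1}^{n} xᵢ ≥ P and xᵢ ∈ {0} ∪ [mᵢ, Mᵢ] for all i. Let G = { i : mᵢ < x*ᵢ < Mᵢ } and H = |G|, and let F = {1,…,n} \ G. Then for every i ∈ G, x*ᵢ = (P − ∑_{j∈F} x*_j)/H + λ·(∑_{j∈G} β_j − H·βᵢ)/(H·c). -/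
open Classical

open Filter Topology in
/-- First-order optimality condition along a direction `d` supported on coordinates lying
strictly between their bounds. -/
theorem directional_derivative_nonneg {ι : Type*} [Fintype ι] (c lam P : ℝ) (α β m M x d : ι → ℝ)
    (hm : ∀ i, 0 < m i)
    (hx : ∀ i, x i = 0 ∨ (m i ≤ x i ∧ x i ≤ M i))
    (hopt : ∀ y : ι → ℝ, (∑ i, y i ≥ P) → (∀ i, y i = 0 ∨ (m i ≤ y i ∧ y i ≤ M i)) →
      (∑ i, ((if 0 < x i then α i + β i * x i else 0) + c * (x i) ^ 2 / (2 * lam))) ≤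
      (∑ i, ((if 0 < y i then α i + β i * y i else 0) + c * (y i) ^ 2 / (2 * lam))))
    (hd : ∀ i, d i = 0 ∨ (m i < x i ∧ x i < M i))
    (hdem : ∀ᶠ t in 𝓝[>] (0 : ℝ), P ≤ ∑ i, (x i + t * d i)) :
    0 ≤ ∑ i, d i * (β i + c * x i / lam) := by
  set A := ∑ i, d i * (β i + c * x i / lam) with hA
  set B := ∑ i, c * d i ^ 2 / (2 * lam) with hB
  have hcoord : ∀ i, ∀ᶠ t in 𝓝[>] (0 : ℝ),
      d i = 0 ∨ (m i < x i + t * d i ∧ x i + t * d i < M i) := by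
    intro i
    rcases hd i with h | ⟨h₁, h₂⟩
    · exact Eventually.of_forall fun _ => Or.inl h
    · have hlim : Tendsto (fun t : ℝ => x i + t * d i) (𝓝[>] 0) (𝓝 (x i)) := by
        have : Continuous fun t : ℝ => x i + t * d i := by fun_prop
        simpa using (this.tendsto 0).mono_left nhdsWithin_le_nhds
      filter_upwards [hlim.eventually_const_lt h₁, hlim.eventually_lt_const h₂] with t a b
      exact Or.inr ⟨a, b⟩
  have hlim : Tendsto (fun t : ℝ => A + t * B) (𝓝[>] 0) (𝓝 A) := by
    have : Continuous fun t : ℝ => A + t * B := by fun_prop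
    simpa using (this.tendsto 0).mono_left nhdsWithin_le_nhds
  refine ge_of_tendsto hlim ?_
  filter_upwards [hdem, eventually_all.2 hcoord, self_mem_nhdsWithin] with t hP ht htpos
  have htpos : 0 < t := htpos
  have hle := hopt (fun i => x i + t * d i) hP (by
    intro i
    rcases ht i with h | h
    · simpa [h] using hx i
    · exact Or.inr ⟨h.1.le, h.2.le⟩)
  have hsum : ∑ i, ((if 0 < x i + t * d i then α i + β i * (x i + t * d i) else 0) +
        c * (x i + t * d i) ^ 2 / (2 * lam)) =
      ∑ i, ((if 0 < x i then α i + β i * x i else 0) + c * (x i) ^ 2 / (2 * lam)) +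
        t * (A + t * B) := by
    rw [hA, hB, Finset.mul_sum, ← Finset.sum_add_distrib, Finset.mul_sum,
      ← Finset.sum_add_distrib]
    refine Finset.sum_congr rfl fun i _ => ?_
    by_cases h : d i = 0
    · simp [h]
    · have h₁ : 0 < x i + t * d i := (hm i).trans ((ht i).resolve_left h).1
      have h₂ : 0 < x i := (hm i).trans ((hd i).resolve_left h).1
      rw [if_pos h₁, if_pos h₂]
      ring
  rw [hsum] at hle
  exact nonneg_of_mul_nonneg_right (by linarith) htpos

/-- At an optimal solution `x*` of the single-delivery supply problem, the
coordinates lying strictly between their bounds (`i ∈ G`) coincide with the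
unique minimizer of the continuous relaxation with residual demand
`P − ∑_{j∈F} x*ⱼ`, where `F` is the complement of `G` and `H = |G|`. -/
theorem interior_coords_formula
    (n : ℕ) (hn : 1 ≤ n) (c lam P : ℝ) (hc : 0 < c) (hlam : 0 < lam)
    (hP : 0 ≤ P) (α β : Fin n → ℝ) (hα : ∀ i, 0 ≤ α i) (hβ : ∀ i, 0 ≤ β i)
    (m M : Fin n → ℝ) (hm : ∀ i, 0 < m i) (hmM : ∀ i, m i ≤ M i)
    (xstar : Fin n → ℝ)
    (hfeas : (∑ i, xstar i ≥ P) ∧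
      ∀ i, xstar i = 0 ∨ (m i ≤ xstar i ∧ xstar i ≤ M i))
    (hopt : ∀ x : Fin n → ℝ,
      (∑ i, x i ≥ P) → (∀ i, x i = 0 ∨ (m i ≤ x i ∧ x i ≤ M i)) →
      (∑ i, ((if 0 < xstar i then α i + β i * xstar i else 0) +
          c * (xstar i) ^ 2 / (2 * lam))) ≤
      (∑ i, ((if 0 < x i then α i + β i * x i else 0) +
          c * (x i) ^ 2 / (2 * lam)))) :
    let G : Finset (Fin n) :=
      Finset.univ.filter (fun i => m i < xstar i ∧ xstar i < M i)
    let H : ℕ := G.card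
    ∀ i ∈ G,
      xstar i = (P - ∑ j ∈ Gᶜ, xstar j) / H +
        lam * ((∑ j ∈ G, β j) - (H : ℝ) * β i) / ((H : ℝ) * c) := by
  intro G H i hi
  obtain ⟨hdemand, hx⟩ := hfeas
  have hG : ∀ j ∈ G, m j < xstar j ∧ xstar j < M j := fun j hj => (Finset.mem_filter.1 hj).2
  have hfirst := fun d => directional_derivative_nonneg c lam P α β m M xstar d hm hx hopt
  have hmarg : ∀ j ∈ G, ∀ k ∈ G,
      β k + c * xstar k / lam ≤ β j + c * xstar j / lam := by
    intro j hj k hk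
    have h := hfirst (Pi.single j 1 - Pi.single k 1) (by
      intro l
      by_cases hlj : l = j
      · exact Or.inr (hlj ▸ hG j hj)
      by_cases hlk : l = k
      · exact Or.inr (hlk ▸ hG k hk)
      · simp [hlj, hlk]) (by
      refine Filter.Eventually.of_forall fun t => ?_
      simpa [Finset.sum_add_distrib, ← Finset.mul_sum] using hdemand)
    simpa [sub_mul, Pi.single_apply] using h
  have htight : ∑ j, xstar j = P := by
    refine le_antisymm (not_lt.1 fun hslack => ?_) hdemand
    have h := hfirst (-Pi.single i 1) (by
      intro l
      by_cases hli : l = i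
      · exact Or.inr (hli ▸ hG i hi)
      · simp [hli]) (by
      filter_upwards [Ioo_mem_nhdsGT (sub_pos.2 hslack)] with t ht
      simp only [Pi.neg_apply, mul_neg, Finset.sum_add_distrib, Finset.sum_neg_distrib,
        ← Finset.mul_sum, Finset.mem_univ, if_true, Pi.single_apply,
        Finset.sum_ite_eq']
      linarith [ht.2])
    have hpos : 0 < β i + c * xstar i / lam :=
      add_pos_of_nonneg_of_pos (hβ i) (div_pos (mul_pos hc ((hm i).trans (hG i hi).1)) hlam)
    simp only [Pi.neg_apply, neg_mul, Finset.sum_neg_distrib, Pi.single_apply, ite_mul, one_mul,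
      zero_mul, Finset.sum_ite_eq', Finset.mem_univ, if_true] at h
    linarith
  have hH : (0 : ℝ) < H := Nat.cast_pos.2 (Finset.card_pos.2 ⟨i, hi⟩)
  have hres : P - ∑ j ∈ Gᶜ, xstar j = ∑ j ∈ G, xstar j := by
    rw [← htight, ← Finset.sum_add_sum_compl G]
    ring
  have hbalance : (H : ℝ) * (β i + c * xstar i / lam) =
      ∑ j ∈ G, β j + c * (∑ j ∈ G, xstar j) / lam := by
    rw [Finset.mul_sum, Finset.sum_div, ← Finset.sum_add_distrib, ← nsmul_eq_mul]
    exact (Finset.sum_eq_card_nsmul fun j hj =>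
      le_antisymm (hmarg i hi j hj) (hmarg j hj i hi)).symm
  rw [hres]
  field_simp at hbalance ⊢
  linarith
end
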